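/- Let X be a compact metric space, T:X→X continuous, η a Borel probability measure on X, ψ:X→ℝ continuous, and ψⁿ := Σ_{j=0}^{n−1} ψ∘T^j. Let Y⊆X be Borel, E:Y→𝒫(ℕ) measurable, and let (n_k) strictly increasing, F⊆ℕ Fölner along (n_k) with positive lower asymptotic density along (n_k), and Borel sets A_{n_k}⊆Y with η(A_{n_k}) > 0 satisfy: ∂F_{n_k} ⊆ E(x) for every x∈A_{n_k}; liminf_k inf_{x∈A_{n_k}} #(F_{n_k} ∩ E(x))/n_k > 0; and limsup_k sup_{x∈A_{n_k}} #(F_{n_k} ∖ Fill^N(E(x)))/n_k → 0 as N → ∞. Suppose there is a > 0 such that for every x∈Y and all integers m > k with k,m∈E(x): ψ^{m−k}(T^k x) > (m−k)·a. Set μ_{n_k} := η(· ∩ A_{n_k})/η(A_{n_k}). Then every weak* cluster point μ of the sequence μ_{n_k}^{F_{n_k}} := (1/#F_{n_k}) Σ_{j∈F_{n_k}} T^j_* μ_{n_k} satisfies: for μ-almost every x the Birkhoff limit ψ̃(x) := lim_n ψⁿ(x)/n exists and ψ̃(x) ≥ a. -/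

import Mathlib

open MeasureTheory Filter Topology Set
open scoped ENNReal NNReal Classical

noncomputable section


/-- `E ∩ {0, …, n-1}` as a finset. -/
def sec (E : Set ℕ) (n : ℕ) : Finset ℕ := (Finset.range n).filter (· ∈ E)

/-- `#(E ∩ {0, …, n-1})`. -/
def secCard (E : Set ℕ) (n : ℕ) : ℕ := (sec E n).card

/-- The boundary `∂E` of a set of integers: the points of `E` one of whose neighbours
(in `ℤ`) lies outside of `E`. -/
def bdry (E : Set ℕ) : Set ℕ := {k | k ∈ E ∧ ((k + 1) ∉ E ∨ k = 0 ∨ (k - 1) ∉ E)}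

/-- The upper asymptotic density of `E` along the subsequence `(n_k)`. -/
def upDensAlong (E : Set ℕ) (nk : ℕ → ℕ) : ℝ :=
  Filter.limsup (fun k => (secCard E (nk k) : ℝ) / (nk k : ℝ)) Filter.atTop

/-- The lower asymptotic density of `E` along the subsequence `(n_k)`. -/
def loDensAlong (E : Set ℕ) (nk : ℕ → ℕ) : ℝ :=
  Filter.liminf (fun k => (secCard E (nk k) : ℝ) / (nk k : ℝ)) Filter.atTop

/-- The upper asymptotic density of `E`. -/
def upDens (E : Set ℕ) : ℝ :=
  Filter.limsup (fun n => (secCard E n : ℝ) / (n : ℝ)) Filter.atTop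

/-- `F` is Fölner along `(n_k)`: its boundary has zero upper asymptotic density along
`(n_k)`. -/
def FolnerAlong (F : Set ℕ) (nk : ℕ → ℕ) : Prop := upDensAlong (bdry F) nk = 0

/-- `Fill^N(E)`: the union of all integer intervals `[a, b)` with `a, b ∈ E` and
`0 < b - a ≤ N`. -/
def fill (N : ℕ) (E : Set ℕ) : Set ℕ :=
  {k | ∃ a ∈ E, ∃ b ∈ E, a ≤ k ∧ k < b ∧ a < b ∧ b - a ≤ N}

/-- The averaged push-forward measure `μ^{F_n} = (1/#F_n) ∑_{j ∈ F_n} T^j_* μ`. -/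
def avgMeas {X : Type*} [MeasurableSpace X] (T : X → X) (F : Set ℕ) (μ : Measure X)
    (n : ℕ) : Measure X :=
  ((secCard F n : ℝ≥0∞))⁻¹ • ∑ j ∈ sec F n, Measure.map (T^[j]) μ

/-- `ν` is a weak* cluster point of the sequence of measures `s`, i.e. the weak* limit of
a subsequence. -/
def WeakClusterPt {X : Type*} [MeasurableSpace X] [TopologicalSpace X]
    (ν : Measure X) (s : ℕ → Measure X) : Prop :=
  ∃ φ : ℕ → ℕ, StrictMono φ ∧
    ∀ g : C(X, ℝ), Tendsto (fun k => ∫ x, g x ∂(s (φ k))) atTop (𝓝 (∫ x, g x ∂ν))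


/-- Running maximum of Birkhoff sums. -/
def runMax {X : Type*} (T : X → X) (f : X → ℝ) : ℕ → X → ℝ
  | 0 => fun _ => 0
  | n + 1 => fun x => max 0 (f x + runMax T f n (T x))

theorem runMax_nonneg {X : Type*} (T : X → X) (f : X → ℝ) (n : ℕ) (x : X) :
    0 ≤ runMax T f n x := by
  cases n with
  | zero => exact le_rfl
  | succ n => exact le_max_left _ _

theorem runMax_le_succ {X : Type*} (T : X → X) (f : X → ℝ) (n : ℕ) (x : X) :
    runMax T f n x ≤ runMax T f (n + 1) x := by
  induction n generalizing x with
  | zero => exact runMax_nonneg T f 1 x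
  | succ n ih => exact max_le_max le_rfl (add_le_add le_rfl (ih (T x)))

theorem runMax_mono {X : Type*} (T : X → X) (f : X → ℝ) (x : X) :
    Monotone (fun n => runMax T f n x) :=
  monotone_nat_of_le_succ (fun n => runMax_le_succ T f n x)

theorem birkhoffSum_le_runMax {X : Type*} (T : X → X) (f : X → ℝ) (n : ℕ) (x : X) :
    birkhoffSum T f n x ≤ runMax T f n x := by
  induction n generalizing x with
  | zero => simp [runMax]
  | succ n ih =>
    rw [birkhoffSum_succ']
    exact le_trans (add_le_add le_rfl (ih (T x))) (le_max_right _ _)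

theorem runMax_le {X : Type*} (T : X → X) (f : X → ℝ) (C : ℝ) (hC : ∀ x, |f x| ≤ C)
    (n : ℕ) (x : X) : runMax T f n x ≤ n * C := by
  induction n generalizing x with
  | zero => simp [runMax]
  | succ n ih =>
    have h0 : 0 ≤ C := (abs_nonneg _).trans (hC x)
    have h1 := ih (T x)
    have h2 := (le_abs_self _).trans (hC x)
    push_cast
    refine max_le (by positivity) (by linarith)

theorem runMax_measurable {X : Type*} [MeasurableSpace X] (T : X → X) (hT : Measurable T)
    (f : X → ℝ) (hf : Measurable f) (n : ℕ) : Measurable (runMax T f n) := by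
  induction n with
  | zero => exact measurable_const
  | succ n ih => exact measurable_const.max (hf.add (ih.comp hT))

theorem max_ergodic {X : Type*} [MeasurableSpace X] (μ : Measure X) [IsFiniteMeasure μ]
    (T : X → X) (hT : MeasurePreserving T μ μ) (f : X → ℝ) (hf : Measurable f)
    (C : ℝ) (hC : ∀ x, |f x| ≤ C)
    (h : ∀ᵐ x ∂μ, ∃ n, 0 < birkhoffSum T f n x) : 0 ≤ ∫ x, f x ∂μ := by
  have hM := runMax_measurable T hT.measurable f hf
  have hMi : ∀ n, Integrable (runMax T f n) μ := fun n =>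
    Integrable.of_bound (hM n).aestronglyMeasurable (n * C) (Eventually.of_forall fun x => by
      rw [Real.norm_eq_abs, abs_of_nonneg (runMax_nonneg T f n x)]
      exact runMax_le T f C hC n x)
  let P : ℕ → Set X := fun n => {x | 0 < runMax T f n x}
  have hP : ∀ n, MeasurableSet (P n) := fun n => measurableSet_lt measurable_const (hM n)
  have hfi : Integrable f μ := Integrable.of_bound hf.aestronglyMeasurable C
    (Eventually.of_forall fun x => hC x)
  have hlim : Tendsto (fun n => ∫ x, (P n).indicator f x ∂μ) atTop (𝓝 (∫ x, f x ∂μ)) := by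
    refine tendsto_integral_of_dominated_convergence (fun _ => C)
      (fun n => (hf.indicator (hP n)).aestronglyMeasurable) (integrable_const C) ?_ ?_
    · intro n
      refine Eventually.of_forall fun x => ?_
      exact (norm_indicator_le_norm_self f x).trans (hC x)
    · filter_upwards [h] with x hx
      obtain ⟨n, hn⟩ := hx
      refine tendsto_const_nhds.congr' ?_
      filter_upwards [eventually_ge_atTop n] with m hm
      have : x ∈ P m :=
        lt_of_lt_of_le (hn.trans_le (birkhoffSum_le_runMax T f n x)) (runMax_mono T f x hm)
      rw [indicator_of_mem this]
  refine ge_of_tendsto hlim ?_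
  filter_upwards [eventually_ge_atTop 1] with n hn
  obtain ⟨n, rfl⟩ : ∃ m, n = m + 1 := ⟨n - 1, by omega⟩
  have hc : Integrable (fun x => runMax T f n (T x)) μ :=
    hT.integrable_comp_of_integrable (hMi n)
  have e : ∫ x, runMax T f n (T x) ∂μ = ∫ x, runMax T f n x ∂μ := by
    conv_rhs => rw [← hT.map_eq]
    rw [integral_map hT.measurable.aemeasurable (hM n).aestronglyMeasurable]
  have h1 : ∫ x, runMax T f n x ∂μ ≤ ∫ x, runMax T f (n + 1) x ∂μ :=
    integral_mono (hMi n) (hMi (n + 1)) (fun x => runMax_le_succ T f n x)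
  have h2 : ∫ x, (runMax T f (n + 1) x - runMax T f n (T x)) ∂μ
      ≤ ∫ x, (P (n + 1)).indicator f x ∂μ := by
    refine integral_mono ((hMi (n + 1)).sub hc) (hfi.indicator (hP _)) (fun x => ?_)
    have h4 := runMax_nonneg T f n (T x)
    have h5 : runMax T f (n + 1) x = max 0 (f x + runMax T f n (T x)) := rfl
    by_cases hx : x ∈ P (n + 1)
    · simp only [indicator_of_mem hx]
      have hx' : 0 < runMax T f (n + 1) x := hx
      rcases le_total 0 (f x + runMax T f n (T x)) with h6 | h6
      · rw [h5, max_eq_right h6]; linarith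
      · rw [h5, max_eq_left h6] at hx'; exact absurd hx' (lt_irrefl _)
    · simp only [indicator_of_notMem hx]
      have hx' : ¬ 0 < runMax T f (n + 1) x := hx
      linarith
  rw [integral_sub (hMi (n + 1)) hc, e] at h2
  linarith

/-- Averages frequently strictly below (some rational below) `α`. -/
def lowSet {X : Type*} (T : X → X) (f : X → ℝ) (α : ℝ) : Set X :=
  {x | ∃ q : ℚ, (q : ℝ) < α ∧ ∃ᶠ n in atTop, birkhoffAverage ℝ T f n x < q}

theorem freq_aux (u v : ℕ → ℝ) (h : Tendsto (fun n => u n - v n) atTop (𝓝 0)) (α : ℝ)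
    (hu : ∃ q : ℚ, (q : ℝ) < α ∧ ∃ᶠ n in atTop, v n < q) :
    ∃ q : ℚ, (q : ℝ) < α ∧ ∃ᶠ n in atTop, u n < q := by
  obtain ⟨q, hq, hf⟩ := hu
  obtain ⟨r, hr, hr'⟩ := exists_rat_btwn hq
  refine ⟨r, hr', ?_⟩
  have h1 : ∀ᶠ n in atTop, u n - v n < r - q := h.eventually_lt_const (by linarith)
  refine (hf.and_eventually h1).mono ?_
  rintro n ⟨h2, h3⟩
  linarith

theorem lowSet_preimage {X : Type*} (T : X → X) (f : X → ℝ) (C : ℝ) (hC : ∀ x, |f x| ≤ C)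
    (α : ℝ) : T ⁻¹' lowSet T f α = lowSet T f α := by
  ext x
  have hb : Bornology.IsBounded (Set.range f) :=
    (Metric.isBounded_iff_subset_closedBall 0).2 ⟨C, by
      rintro _ ⟨y, rfl⟩; simpa using hC y⟩
  have h := tendsto_birkhoffAverage_apply_sub_birkhoffAverage' (𝕜 := ℝ) (f := T) (g := f) hb x
  constructor
  · intro hx
    refine freq_aux _ _ ?_ α hx
    simpa using h.neg
  · intro hx
    exact freq_aux _ _ h α hx

theorem lowSet_measurable {X : Type*} [MeasurableSpace X] (T : X → X) (hT : Measurable T)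
    (f : X → ℝ) (hf : Measurable f) (α : ℝ) : MeasurableSet (lowSet T f α) := by
  have hm : ∀ n, Measurable (birkhoffAverage ℝ T f n) := by
    intro n
    have : birkhoffAverage ℝ T f n
      = fun x => (n : ℝ)⁻¹ • ∑ k ∈ Finset.range n, f (T^[k] x) := by
      ext x; rfl
    rw [this]
    have hs : Measurable (fun x => ∑ k ∈ Finset.range n, f (T^[k] x)) :=
      Finset.measurable_fun_sum _ fun k _ => hf.comp (hT.iterate k)
    exact hs.const_smul ((n : ℝ)⁻¹)
  have : lowSet T f α = ⋃ q : ℚ, ⋂ N : ℕ, ⋃ n : ℕ, {x | ((q : ℝ) < α ∧ N ≤ n) ∧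
      birkhoffAverage ℝ T f n x < q} := by
    ext x
    simp only [lowSet, frequently_atTop, mem_iUnion, mem_iInter, mem_ofPred_eq]
    refine exists_congr fun q => ⟨?_, ?_⟩
    · rintro ⟨h1, h2⟩ N
      obtain ⟨n, h3, h4⟩ := h2 N
      exact ⟨n, ⟨h1, h3⟩, h4⟩
    · intro h
      obtain ⟨_, ⟨h1, _⟩, _⟩ := h 0
      refine ⟨h1, fun N => ?_⟩
      obtain ⟨n, ⟨_, h3⟩, h4⟩ := h N
      exact ⟨n, h3, h4⟩
  rw [this]
  refine MeasurableSet.iUnion fun q => ?_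
  refine MeasurableSet.iInter fun N => MeasurableSet.iUnion fun n => ?_
  exact MeasurableSet.inter (MeasurableSet.const _) (measurableSet_lt (hm n) measurable_const)

theorem low_max {X : Type*} [MeasurableSpace X] (μ : Measure X) [IsFiniteMeasure μ]
    (T : X → X) (hT : MeasurePreserving T μ μ) (f : X → ℝ) (hf : Measurable f)
    (C : ℝ) (hC : ∀ x, |f x| ≤ C) (B : Set X) (hB : MeasurableSet B) (hTB : T ⁻¹' B = B)
    (α : ℝ) (hsub : B ⊆ lowSet T f α) : ∫ x in B, f x ∂μ ≤ α * μ.real B := by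
  have hp : MeasurePreserving T (μ.restrict B) (μ.restrict B) := by
    have := hT.restrict_preimage hB
    rwa [hTB] at this
  have hfi : Integrable f (μ.restrict B) := Integrable.of_bound hf.aestronglyMeasurable C
    (Eventually.of_forall fun x => hC x)
  have := max_ergodic (μ.restrict B) T hp (fun x => α - f x) (by fun_prop) (|α| + C)
    (fun x => (abs_sub _ _).trans (add_le_add le_rfl (hC x))) ?_
  · rw [integral_sub (integrable_const _) hfi] at this
    simp only [integral_const, smul_eq_mul, measureReal_restrict_apply_univ] at this
    linarith
  · filter_upwards [ae_restrict_mem hB] with x hx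
    obtain ⟨q, hq, hf⟩ := hsub hx
    obtain ⟨n, hn, h1⟩ := (frequently_atTop.1 hf) 1
    refine ⟨n, ?_⟩
    have hn' : (0 : ℝ) < n := by exact_mod_cast hn
    have h2 : birkhoffAverage ℝ T f n x = (n : ℝ)⁻¹ * birkhoffSum T f n x := rfl
    rw [h2, inv_mul_lt_iff₀ hn'] at h1
    have h3 : birkhoffSum T (fun x => α - f x) n x = n * α - birkhoffSum T f n x := by
      simp [birkhoffSum, Finset.sum_sub_distrib]
    rw [h3]
    nlinarith

theorem birkhoff_pointwise {X : Type*} [MeasurableSpace X] (μ : Measure X) [IsFiniteMeasure μ]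
    (T : X → X) (hT : MeasurePreserving T μ μ) (f : X → ℝ) (hf : Measurable f)
    (C : ℝ) (hC : ∀ x, |f x| ≤ C) :
    ∀ᵐ x ∂μ, ∃ L : ℝ, Tendsto (fun n => birkhoffAverage ℝ T f n x) atTop (𝓝 L) := by
  have hC' : ∀ x, |(-f) x| ≤ C := fun x => by simpa using hC x
  have key : ∀ p : ℚ × ℚ, p.1 < p.2 →
      ∀ᵐ x ∂μ, x ∉ lowSet T f p.1 ∩ lowSet T (-f) (-(p.2 : ℝ)) := by
    rintro ⟨α, β⟩ hab
    simp only at hab ⊢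
    set B := lowSet T f α ∩ lowSet T (-f) (-(β : ℝ)) with hBdef
    have hB : MeasurableSet B := (lowSet_measurable T hT.measurable f hf _).inter
      (lowSet_measurable T hT.measurable (-f) hf.neg _)
    have hTB : T ⁻¹' B = B := by
      rw [hBdef, preimage_inter, lowSet_preimage T f C hC, lowSet_preimage T (-f) C hC']
    have h1 := low_max μ T hT f hf C hC B hB hTB α inter_subset_left
    have h2 := low_max μ T hT (-f) hf.neg C hC' B hB hTB (-β) inter_subset_right
    simp only [Pi.neg_apply, integral_neg] at h2
    have h3 : (α : ℝ) < β := by exact_mod_cast hab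
    have h4 : 0 ≤ μ.real B := measureReal_nonneg
    have h5 : μ.real B = 0 := by nlinarith
    have h6 : μ B = 0 := (measureReal_eq_zero_iff).1 h5
    exact measure_eq_zero_iff_ae_notMem.1 h6
  have key' : ∀ᵐ x ∂μ, ∀ p : ℚ × ℚ, p.1 < p.2 →
      x ∉ lowSet T f p.1 ∩ lowSet T (-f) (-(p.2 : ℝ)) := by
    rw [ae_all_iff]; intro p
    by_cases hp : p.1 < p.2
    · filter_upwards [key p hp] with x hx _ using hx
    · exact Eventually.of_forall fun x h => absurd h hp
  filter_upwards [key'] with x hx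
  have hbd : ∀ n, |birkhoffAverage ℝ T f n x| ≤ C := by
    intro n
    have h0 : 0 ≤ C := (abs_nonneg _).trans (hC x)
    have h2 : birkhoffAverage ℝ T f n x = (n : ℝ)⁻¹ * birkhoffSum T f n x := rfl
    have h3 : |birkhoffSum T f n x| ≤ n * C := by
      refine (Finset.abs_sum_le_sum_abs _ _).trans ?_
      refine (Finset.sum_le_card_nsmul _ _ C fun i _ => hC _).trans ?_
      simp
    rw [h2, abs_mul, abs_inv, Nat.abs_cast]
    rcases Nat.eq_zero_or_pos n with rfl | hn
    · simpa using h0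
    · have hn' : (0 : ℝ) < n := by exact_mod_cast hn
      rwa [inv_mul_le_iff₀ hn']
  refine tendsto_of_no_upcrossings (s := Set.range ((↑) : ℚ → ℝ)) Rat.isDenseEmbedding_coe_real.dense
    ?_ ?_ ?_
  · rintro _ ⟨α, rfl⟩ _ ⟨β, rfl⟩ hab ⟨h1, h2⟩
    have hab' : α < β := by exact_mod_cast hab
    obtain ⟨a', ha1, ha2⟩ := exists_between hab'
    obtain ⟨b', hb1, hb2⟩ := exists_between ha2
    refine hx (a', b') hb1 ⟨⟨α, by exact_mod_cast ha1, h1⟩, ⟨-β, ?_, ?_⟩⟩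
    · push_cast; exact neg_lt_neg (by exact_mod_cast hb2)
    · refine h2.mono fun n hn => ?_
      rw [birkhoffAverage_neg]
      push_cast
      exact neg_lt_neg hn
  · exact ⟨C, eventually_map.2 (Eventually.of_forall fun n => (abs_le.1 (hbd n)).2)⟩
  · exact ⟨-C, eventually_map.2 (Eventually.of_forall fun n => (abs_le.1 (hbd n)).1)⟩

theorem avg_le {X : Type*} [MetricSpace X] [CompactSpace X] [MeasurableSpace X] [BorelSpace X]
    (T : X → X) (hT : Continuous T) (η : Measure X) [IsProbabilityMeasure η] (F : Set ℕ)
    (A : Set X) (hA : MeasurableSet A) (hpos : 0 < η A) (n : ℕ) (hn : 0 < secCard F n)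
    (g : C(X, ℝ)) (c : ℝ)
    (h : ∀ x ∈ A, ∑ j ∈ sec F n, g (T^[j] x) ≤ c * secCard F n) :
    ∫ x, g x ∂(avgMeas T F ((η A)⁻¹ • η.restrict A) n) ≤ c := by
  have hP : IsProbabilityMeasure ((η A)⁻¹ • η.restrict A) :=
    ProbabilityTheory.cond_isProbabilityMeasure hpos.ne'
  have hae : ∀ᵐ x ∂((η A)⁻¹ • η.restrict A), x ∈ A :=
    Measure.ae_smul_measure (ae_restrict_mem hA) _
  set μ := (η A)⁻¹ • η.restrict A with hμ
  have hi : ∀ j, Integrable (fun x => g (T^[j] x)) μ := fun j =>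
    (BoundedContinuousFunction.mkOfCompact
      (⟨fun x => g (T^[j] x), g.continuous.comp (hT.iterate j)⟩ : C(X, ℝ))).integrable μ
  have hTm : ∀ j, Measurable (T^[j]) := fun j => (hT.iterate j).measurable
  have hprob : ∀ j, IsProbabilityMeasure (Measure.map (T^[j]) μ) := fun j =>
    Measure.isProbabilityMeasure_map (hTm j).aemeasurable
  have hn' : (0 : ℝ) < secCard F n := by exact_mod_cast hn
  unfold avgMeas
  rw [integral_smul_measure, integral_finsetSum_measure]
  · have e : ∀ j ∈ sec F n, ∫ x, g x ∂(Measure.map (T^[j]) μ) = ∫ x, g (T^[j] x) ∂μ := by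
      intro j _
      rw [integral_map (hTm j).aemeasurable g.continuous.aestronglyMeasurable]
    rw [Finset.sum_congr rfl e, ← integral_finsetSum _ (fun j _ => hi j)]
    have h1 : ∫ x, ∑ j ∈ sec F n, g (T^[j] x) ∂μ ≤ ∫ x, c * secCard F n ∂μ := by
      refine integral_mono_ae (integrable_finsetSum _ fun j _ => hi j) (integrable_const _) ?_
      filter_upwards [hae] with x hx using h x hx
    simp only [integral_const, probReal_univ, smul_eq_mul, one_mul] at h1
    simp only [ENNReal.toReal_inv, ENNReal.toReal_natCast, smul_eq_mul]
    rw [inv_mul_le_iff₀ hn']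
    linarith
  · intro j _
    exact (BoundedContinuousFunction.mkOfCompact g).integrable _

/-- Number of exit points of the section. -/
def exitCard (F : Set ℕ) (n : ℕ) : ℕ := ((sec F n).filter (fun j => j + 1 ∉ sec F n)).card

theorem mem_sec {E : Set ℕ} {n j : ℕ} : j ∈ sec E n ↔ j < n ∧ j ∈ E := by
  simp [sec]

theorem exitCard_le (F : Set ℕ) (n : ℕ) : exitCard F n ≤ secCard (bdry F) n + 1 := by
  refine (Finset.card_le_card (t := insert (n - 1) (sec (bdry F) n)) ?_).trans
    (Finset.card_insert_le _ _)
  intro j hj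
  simp only [Finset.mem_filter, mem_sec, Finset.mem_insert] at hj ⊢
  obtain ⟨⟨h1, h2⟩, h3⟩ := hj
  by_cases h4 : j + 1 < n
  · exact Or.inr ⟨h1, h2, Or.inl fun h5 => h3 ⟨h4, h5⟩⟩
  · left; omega

theorem shift_le (F : Set ℕ) (n S : ℕ) :
    ((sec F n).filter (fun j => j + S ∉ sec F n)).card ≤ S * exitCard F n := by
  induction S with
  | zero =>
    simp only [zero_mul, Nat.le_zero, Finset.card_eq_zero]
    ext j; simp
  | succ S ih =>
    have h1 : (sec F n).filter (fun j => j + (S + 1) ∉ sec F n) ⊆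
        (sec F n).filter (fun j => j + S ∉ sec F n) ∪
        (sec F n).filter (fun j => j + S ∈ sec F n ∧ j + (S + 1) ∉ sec F n) := by
      intro j hj
      simp only [Finset.mem_filter, Finset.mem_union] at hj ⊢
      tauto
    have h2 : ((sec F n).filter (fun j => j + S ∈ sec F n ∧ j + (S + 1) ∉ sec F n)).card
        ≤ exitCard F n := by
      refine Finset.card_le_card_of_injOn (fun j => j + S) ?_ ?_
      · intro j hj
        have hj' := (Finset.mem_filter.1 hj).2
        exact Finset.mem_coe.2 (Finset.mem_filter.2 ⟨hj'.1, by simpa [add_assoc] using hj'.2⟩)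
      · intro i _ j _ h
        simpa using h
    have h3 := (Finset.card_le_card h1).trans (Finset.card_union_le _ _)
    rw [add_mul, one_mul]
    omega

theorem shift_sum (F : Set ℕ) (n : ℕ) (u : ℕ → ℝ) (C : ℝ) (hu : ∀ j, |u j| ≤ C) :
    ∑ j ∈ sec F n, (u (j + 1) - u j) ≤ 2 * C * exitCard F n := by
  set w : ℕ → ℝ := fun j => u j + C with hw
  have hw0 : ∀ j, 0 ≤ w j := fun j => by have := (abs_le.1 (hu j)).1; simp only [hw]; linarith
  have hw1 : ∀ j, w j ≤ 2 * C := fun j => by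
    have := (abs_le.1 (hu j)).2; simp only [hw]; linarith
  have e : ∑ j ∈ sec F n, (u (j + 1) - u j) = ∑ j ∈ sec F n, w (j + 1) - ∑ j ∈ sec F n, w j := by
    rw [← Finset.sum_sub_distrib]
    refine Finset.sum_congr rfl fun j _ => ?_
    simp only [hw]; ring
  rw [e, ← Finset.sum_filter_add_sum_filter_not (sec F n) (fun j => j + 1 ∈ sec F n)]
  have h1 : ∑ j ∈ (sec F n).filter (fun j => j + 1 ∈ sec F n), w (j + 1)
      ≤ ∑ j ∈ sec F n, w j := by
    rw [← Finset.sum_image (s := (sec F n).filter (fun j => j + 1 ∈ sec F n))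
      (g := fun j => j + 1) (f := w) (by intro i _ j _ h; simpa using h)]
    refine Finset.sum_le_sum_of_subset_of_nonneg ?_ (fun j _ _ => hw0 j)
    intro i hi
    obtain ⟨j, hj, rfl⟩ := Finset.mem_image.1 hi
    exact (Finset.mem_filter.1 hj).2
  have h2 : ∑ j ∈ (sec F n).filter (fun j => j + 1 ∉ sec F n), w (j + 1)
      ≤ 2 * C * exitCard F n := by
    refine (Finset.sum_le_card_nsmul _ _ (2 * C) fun i _ => hw1 _).trans ?_
    rw [nsmul_eq_mul, mul_comm]; rfl
  linarith

/-- Clamp to `[0,1]`. -/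
def clamp (t : ℝ) : ℝ := max 0 (min 1 t)

theorem clamp_cont : Continuous clamp := by unfold clamp; fun_prop

theorem clamp_nonneg (t : ℝ) : 0 ≤ clamp t := le_max_left _ _
theorem clamp_le (t : ℝ) : clamp t ≤ 1 := max_le zero_le_one (min_le_left _ _)
theorem clamp_zero {t : ℝ} (h : t ≤ 0) : clamp t = 0 := by
  unfold clamp
  exact max_eq_left ((min_le_right _ _).trans h)
theorem clamp_one {t : ℝ} (h : 1 ≤ t) : clamp t = 1 := by
  unfold clamp
  rw [min_eq_left h]; exact max_eq_right zero_le_one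

/-- The gap function. -/
def gap {X : Type*} (T : X → X) (ψ : X → ℝ) (a : ℝ) (k m : ℕ) (x : X) : ℝ :=
  ((m : ℝ) - k) * a - (birkhoffSum T ψ m x - birkhoffSum T ψ k x)

theorem birkhoffSum_cont {X : Type*} [TopologicalSpace X] (T : X → X) (hT : Continuous T)
    (ψ : X → ℝ) (hψ : Continuous ψ) (n : ℕ) : Continuous (birkhoffSum T ψ n) := by
  have : birkhoffSum T ψ n = fun x => ∑ k ∈ Finset.range n, ψ (T^[k] x) := by ext x; rfl
  rw [this]
  exact continuous_finsetSum _ fun k _ => hψ.comp (hT.iterate k)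

theorem gap_cont {X : Type*} [TopologicalSpace X] (T : X → X) (hT : Continuous T)
    (ψ : X → ℝ) (hψ : Continuous ψ) (a : ℝ) (k m : ℕ) : Continuous (gap T ψ a k m) := by
  have h1 := birkhoffSum_cont T hT ψ hψ k
  have h2 := birkhoffSum_cont T hT ψ hψ m
  unfold gap
  fun_prop

/-- Test function: vanishes as soon as one pair is good, equal to one if all are bad. -/
def testFn {X : Type*} (T : X → X) (ψ : X → ℝ) (a : ℝ) (N S : ℕ) (x : X) : ℝ :=
  ∏ p ∈ Finset.range (N + 1) ×ˢ Finset.range (N + 1), clamp (gap T ψ a p.1 (S + p.2) x)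

theorem testFn_cont {X : Type*} [TopologicalSpace X] (T : X → X) (hT : Continuous T)
    (ψ : X → ℝ) (hψ : Continuous ψ) (a : ℝ) (N S : ℕ) : Continuous (testFn T ψ a N S) :=
  continuous_finsetProd _ fun p _ => clamp_cont.comp (gap_cont T hT ψ hψ a p.1 (S + p.2))

theorem testFn_nonneg {X : Type*} (T : X → X) (ψ : X → ℝ) (a : ℝ) (N S : ℕ) (x : X) :
    0 ≤ testFn T ψ a N S x := Finset.prod_nonneg fun _ _ => clamp_nonneg _

theorem testFn_le {X : Type*} (T : X → X) (ψ : X → ℝ) (a : ℝ) (N S : ℕ) (x : X) :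
    testFn T ψ a N S x ≤ 1 :=
  Finset.prod_le_one (fun _ _ => clamp_nonneg _) fun _ _ => clamp_le _

/-- Times which are good. -/
theorem testFn_good {X : Type*} (T : X → X) (ψ : X → ℝ) (a : ℝ) (N S : ℕ) (hS : N ≤ S) (x : X)
    (E : Set ℕ) (hgrow : ∀ k m : ℕ, k ∈ E → m ∈ E → k < m →
      ((m : ℝ) - k) * a < ∑ j ∈ Finset.Ico k m, ψ (T^[j] x))
    (j : ℕ) (h1 : j ∈ fill N E) (h2 : j + S ∈ fill N E) : testFn T ψ a N S (T^[j] x) = 0 := by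
  obtain ⟨p, hp, b, hb, hpj, hjb, hpb, hN⟩ := h1
  obtain ⟨p', hp', b', hb', hpj', hjb', hpb', hN'⟩ := h2
  obtain ⟨i, rfl⟩ : ∃ i, b = j + i := ⟨b - j, by omega⟩
  obtain ⟨i', rfl⟩ : ∃ i', b' = j + (S + i') := ⟨b' - j - S, by omega⟩
  refine Finset.prod_eq_zero (i := (i, i')) ?_ (clamp_zero ?_)
  · simp only [Finset.mem_product, Finset.mem_range]; omega
  · have h := hgrow (j + i) (j + (S + i')) hb hb' (by omega)
    have e1 : ∀ m, birkhoffSum T ψ m (T^[j] x) = ∑ l ∈ Finset.Ico j (j + m), ψ (T^[l] x) := by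
      intro m
      rw [Finset.sum_Ico_eq_sum_range]
      simp only [birkhoffSum, Nat.add_sub_cancel_left]
      refine Finset.sum_congr rfl fun l _ => ?_
      rw [← Function.iterate_add_apply, add_comm]
    have e2 := Finset.sum_Ico_consecutive (fun l => ψ (T^[l] x)) (m := j) (n := j + i)
      (k := j + (S + i')) (by omega) (by omega)
    unfold gap
    simp only [e1]
    push_cast at h ⊢
    rw [← e2]
    nlinarith [h]

theorem test_sum {X : Type*} (T : X → X) (ψ : X → ℝ) (a : ℝ) (N S : ℕ) (hS : N ≤ S) (x : X)
    (E : Set ℕ) (hgrow : ∀ k m : ℕ, k ∈ E → m ∈ E → k < m →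
      ((m : ℝ) - k) * a < ∑ j ∈ Finset.Ico k m, ψ (T^[j] x))
    (F : Set ℕ) (n : ℕ) :
    ∑ j ∈ sec F n, testFn T ψ a N S (T^[j] x)
      ≤ 2 * secCard (F \ fill N E) n + S * exitCard F n := by
  set B1 := (sec F n).filter (fun j => j ∉ fill N E)
  set B2 := (sec F n).filter (fun j => j + S ∈ sec F n ∧ j + S ∉ fill N E)
  set B3 := (sec F n).filter (fun j => j + S ∉ sec F n)
  have h1 : B1.card ≤ secCard (F \ fill N E) n := by
    refine Finset.card_le_card fun j hj => ?_
    simp only [B1, Finset.mem_filter, mem_sec] at hj ⊢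
    exact ⟨hj.1.1, hj.1.2, hj.2⟩
  have h2 : B2.card ≤ secCard (F \ fill N E) n := by
    refine Finset.card_le_card_of_injOn (fun j => j + S) ?_ ?_
    · intro j hj
      have hj' := (Finset.mem_filter.1 hj).2
      have := mem_sec.1 hj'.1
      exact Finset.mem_coe.2 (mem_sec.2 ⟨this.1, this.2, hj'.2⟩)
    · intro i _ j _ h
      simpa using h
  have h3 : B3.card ≤ S * exitCard F n := shift_le F n S
  have h4 : ∑ j ∈ sec F n, testFn T ψ a N S (T^[j] x)
      ≤ ∑ j ∈ sec F n, if j ∈ B1 ∪ B2 ∪ B3 then (1 : ℝ) else 0 := by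
    refine Finset.sum_le_sum fun j hj => ?_
    split_ifs with hb
    · exact testFn_le _ _ _ _ _ _
    · simp only [B1, B2, B3, Finset.mem_union, Finset.mem_filter] at hb
      refine (testFn_good T ψ a N S hS x E hgrow j ?_ ?_).le <;> tauto
  refine h4.trans ?_
  rw [← Finset.sum_filter, Finset.sum_const, nsmul_eq_mul, mul_one]
  have h5 : ((sec F n).filter (fun j => j ∈ B1 ∪ B2 ∪ B3)).card ≤ B1.card + B2.card + B3.card := by
    refine (Finset.card_le_card (t := B1 ∪ B2 ∪ B3) fun j hj => (Finset.mem_filter.1 hj).2).trans ?_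
    refine (Finset.card_union_le _ _).trans (add_le_add (Finset.card_union_le _ _) le_rfl)
  have h6 : ((sec F n).filter (fun j => j ∈ B1 ∪ B2 ∪ B3)).card
      ≤ 2 * secCard (F \ fill N E) n + S * exitCard F n := by omega
  exact_mod_cast h6

theorem ratio_le_one (E : Set ℕ) (n : ℕ) : (secCard E n : ℝ) / n ≤ 1 := by
  refine div_le_one_of_le₀ ?_ (by positivity)
  have : secCard E n ≤ n := by
    have := Finset.card_filter_le (Finset.range n) (· ∈ E)
    rw [Finset.card_range] at this
    exact this
  exact_mod_cast this

theorem ratio_nonneg (E : Set ℕ) (n : ℕ) : 0 ≤ (secCard E n : ℝ) / n := by positivity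

/-- (Growth of the cocycle along the good times forces a positive a.e.
Birkhoff limit for weak* cluster points of the averaged conditional measures.) -/
theorem folner_birkhoff_lower_bound {X : Type*} [MetricSpace X] [CompactSpace X]
    [MeasurableSpace X] [BorelSpace X]
    (T : X → X) (hT : Continuous T)
    (η : Measure X) (hη : IsProbabilityMeasure η)
    (ψ : X → ℝ) (hψ : Continuous ψ)
    (Y : Set X) (hY : MeasurableSet Y)
    (E : X → Set ℕ) (hE : ∀ n : ℕ, MeasurableSet {x | n ∈ E x})
    (nk : ℕ → ℕ) (hnk : StrictMono nk)
    (F : Set ℕ) (hFol : FolnerAlong F nk) (hdens : 0 < loDensAlong F nk)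
    (A : ℕ → Set X) (hAmeas : ∀ k, MeasurableSet (A k)) (hAY : ∀ k, A k ⊆ Y)
    (hApos : ∀ k, 0 < η (A k))
    (hbdry : ∀ k, ∀ x ∈ A k, bdry (F ∩ Set.Iio (nk k)) ⊆ E x)
    (hinter : 0 < Filter.liminf
      (fun k => ⨅ x : A k, (secCard (F ∩ E x.1) (nk k) : ℝ) / (nk k : ℝ)) Filter.atTop)
    (hfill : Tendsto (fun N : ℕ => Filter.limsup
        (fun k => ⨆ x : A k, (secCard (F \ fill N (E x.1)) (nk k) : ℝ) / (nk k : ℝ))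
        Filter.atTop)
      atTop (𝓝 (0 : ℝ)))
    (a : ℝ) (ha : 0 < a)
    (hgrow : ∀ x ∈ Y, ∀ k m : ℕ, k ∈ E x → m ∈ E x → k < m →
      ((m : ℝ) - k) * a < ∑ j ∈ Finset.Ico k m, ψ (T^[j] x))
    (ν : Measure X) (hfin : IsFiniteMeasure ν)
    (hcl : WeakClusterPt ν
      (fun k => avgMeas T F ((η (A k))⁻¹ • η.restrict (A k)) (nk k))) :
    ∀ᵐ x ∂ν, ∃ L : ℝ,
      Tendsto (fun n : ℕ => (∑ j ∈ Finset.range n, ψ (T^[j] x)) / n) atTop (𝓝 L) ∧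
      a ≤ L := by
  have := hη
  have := hfin
  have hnk' : Tendsto (fun k => (nk k : ℝ)) atTop atTop :=
    tendsto_natCast_atTop_atTop.comp hnk.tendsto_atTop
  have hnkpos : ∀ᶠ k in atTop, (0 : ℝ) < nk k := hnk'.eventually_gt_atTop 0
  have hbA : ∀ (G : ℕ → ℝ), (∀ k, G k ≤ 1) → IsBoundedUnder (· ≤ ·) atTop G := fun G h =>
    ⟨1, eventually_map.2 (Eventually.of_forall h)⟩
  have hbB : ∀ (G : ℕ → ℝ), (∀ k, 0 ≤ G k) → IsBoundedUnder (· ≥ ·) atTop G := fun G h =>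
    ⟨0, eventually_map.2 (Eventually.of_forall h)⟩
  -- lower density
  obtain ⟨c₀, hc₀, hc₁⟩ := exists_between hdens
  have hcard : ∀ᶠ k in atTop, c₀ * nk k ≤ secCard F (nk k) := by
    have := eventually_lt_of_lt_liminf hc₁ (hbB _ fun k => ratio_nonneg F (nk k))
    filter_upwards [this, hnkpos] with k h1 h2
    exact ((lt_div_iff₀ h2).1 h1).le
  -- exit points
  have hexit : ∀ δ : ℝ, 0 < δ → ∀ᶠ k in atTop, (exitCard F (nk k) : ℝ) ≤ δ * nk k := by
    intro δ hδ
    have h0 : upDensAlong (bdry F) nk < δ / 2 := by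
      have : upDensAlong (bdry F) nk = 0 := hFol
      rw [this]; positivity
    have h1 := eventually_lt_of_limsup_lt h0 (hbA _ fun k => ratio_le_one (bdry F) (nk k))
    filter_upwards [h1, hnkpos, hnk'.eventually_ge_atTop (2 / δ)] with k h1 h2 h3
    have h4 := (div_lt_iff₀ h2).1 h1
    rw [div_le_iff₀ hδ] at h3
    have h5 : (exitCard F (nk k) : ℝ) ≤ secCard (bdry F) (nk k) + 1 := by
      exact_mod_cast exitCard_le F (nk k)
    linarith
  -- fill
  have hfill' : ∀ δ : ℝ, 0 < δ → ∃ N : ℕ, ∀ᶠ k in atTop, ∀ x ∈ A k,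
      (secCard (F \ fill N (E x)) (nk k) : ℝ) ≤ δ * nk k := by
    intro δ hδ
    obtain ⟨N, hN⟩ := (hfill.eventually_lt_const hδ).exists
    refine ⟨N, ?_⟩
    have h1 := eventually_lt_of_limsup_lt hN (hbA _ fun k =>
      Real.iSup_le (fun x => ratio_le_one _ _) zero_le_one)
    filter_upwards [h1, hnkpos] with k h1 h2 x hx
    have h3 : (secCard (F \ fill N (E x)) (nk k) : ℝ) / (nk k : ℝ) ≤ _ :=
      le_ciSup (f := fun x : A k => (secCard (F \ fill N (E x.1)) (nk k) : ℝ) / (nk k : ℝ))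
        ⟨1, by rintro _ ⟨y, rfl⟩; exact ratio_le_one _ _⟩ ⟨x, hx⟩
    exact ((div_lt_iff₀ h2).1 (h3.trans_lt h1)).le
  obtain ⟨φ, hφ, hlim⟩ := hcl
  -- transfer principle
  have transfer : ∀ (g : C(X, ℝ)) (c : ℝ), (∀ᶠ k in atTop, ∀ x ∈ A k,
      ∑ j ∈ sec F (nk k), g (T^[j] x) ≤ c * secCard F (nk k)) → ∫ x, g x ∂ν ≤ c := by
    intro g c hg
    refine le_of_tendsto (hlim g) ?_
    have hφ' := hφ.tendsto_atTop
    filter_upwards [hφ'.eventually hg, hφ'.eventually hcard, hφ'.eventually hnkpos] with i h1 h2 h3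
    set k := φ i
    refine avg_le T hT η F (A k) (hAmeas k) (hApos k) (nk k) ?_ g c h1
    have : (0 : ℝ) < secCard F (nk k) := (mul_pos hc₀ h3).trans_le h2
    exact_mod_cast this
  have hgInt : ∀ g : C(X, ℝ), Integrable (fun x => g x) ν := fun g =>
    (BoundedContinuousFunction.mkOfCompact g).integrable ν
  -- invariance
  have inv_le : ∀ g : C(X, ℝ), ∫ x, g (T x) ∂ν ≤ ∫ x, g x ∂ν := by
    intro g
    let gT : C(X, ℝ) := g.comp ⟨T, hT⟩
    have h : ∀ ε : ℝ, 0 < ε → ∫ x, (gT - g) x ∂ν ≤ ε := by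
      intro ε hε
      refine transfer (gT - g) ε ?_
      have hpos : 0 < ε * c₀ / (2 * ‖g‖ + 1) := by positivity
      filter_upwards [hexit _ hpos, hcard, hnkpos] with k h1 h2 h3 x hx
      have h4 := shift_sum F (nk k) (fun j => g (T^[j] x)) ‖g‖ (fun j => g.norm_coe_le_norm _)
      have e : ∑ j ∈ sec F (nk k), (gT - g) (T^[j] x)
          = ∑ j ∈ sec F (nk k), (g (T^[j + 1] x) - g (T^[j] x)) := by
        refine Finset.sum_congr rfl fun j _ => ?_
        rw [Function.iterate_succ_apply']; rfl
      rw [e]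
      refine h4.trans ?_
      have h5 : 2 * ‖g‖ * (exitCard F (nk k) : ℝ) ≤ (2 * ‖g‖ + 1) * exitCard F (nk k) :=
        mul_le_mul_of_nonneg_right (by linarith) (by positivity)
      have h6 : (2 * ‖g‖ + 1) * (exitCard F (nk k) : ℝ)
          ≤ (2 * ‖g‖ + 1) * (ε * c₀ / (2 * ‖g‖ + 1) * nk k) :=
        mul_le_mul_of_nonneg_left h1 (by positivity)
      have h7 : (2 * ‖g‖ + 1) * (ε * c₀ / (2 * ‖g‖ + 1) * nk k) = ε * (c₀ * nk k) := by
        field_simp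
      have h8 : ε * (c₀ * nk k) ≤ ε * secCard F (nk k) := mul_le_mul_of_nonneg_left h2 hε.le
      linarith
    have h' : ∫ x, (gT - g) x ∂ν ≤ 0 := le_of_forall_pos_le_add fun ε hε => by
      simpa using h ε hε
    have e : ∫ x, (gT - g) x ∂ν = ∫ x, g (T x) ∂ν - ∫ x, g x ∂ν :=
      integral_sub (hgInt gT) (hgInt g)
    linarith
  have hmp : MeasurePreserving T ν ν := by
    refine ⟨hT.measurable, ?_⟩
    have : IsFiniteMeasure (Measure.map T ν) := Measure.isFiniteMeasure_map ν T
    refine ext_of_forall_integral_eq_of_IsFiniteMeasure fun f => ?_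
    rw [integral_map hT.measurable.aemeasurable f.continuous.aestronglyMeasurable]
    have h1 := inv_le f.toContinuousMap
    have h2 := inv_le (-f.toContinuousMap)
    simp only [ContinuousMap.neg_apply, integral_neg] at h2
    exact le_antisymm h1 (by simpa using h2)
  let ψc : C(X, ℝ) := ⟨ψ, hψ⟩
  have hBirk := birkhoff_pointwise ν T hmp ψ hψ.measurable ‖ψc‖ (fun x => ψc.norm_coe_le_norm x)
  -- key estimate
  let bad : ℕ → ℕ → Set X := fun N S => {x | 1 ≤ testFn T ψ a N S x}
  have key : ∀ ε : ℝ, 0 < ε → ∃ N : ℕ, ∀ S, N ≤ S → ν (bad N S) ≤ ENNReal.ofReal ε := by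
    intro ε hε
    have hδ : 0 < ε * c₀ / 3 := by positivity
    obtain ⟨N, hN⟩ := hfill' _ hδ
    refine ⟨N, fun S hS => ?_⟩
    let g : C(X, ℝ) := ⟨testFn T ψ a N S, testFn_cont T hT ψ hψ a N S⟩
    have h1 : ∫ x, g x ∂ν ≤ ε := by
      refine transfer g ε ?_
      have hpos : 0 < ε * c₀ / 3 / (S + 1) := by positivity
      filter_upwards [hN, hexit _ hpos, hcard, hnkpos] with k h1 h2 h3 h4 x hx
      have h5 := test_sum T ψ a N S hS x (E x) (hgrow x (hAY k hx)) F (nk k)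
      refine h5.trans ?_
      have h6 := h1 x hx
      have h7 : (S : ℝ) * exitCard F (nk k) ≤ (S + 1) * exitCard F (nk k) :=
        mul_le_mul_of_nonneg_right (by linarith) (by positivity)
      have h8 : ((S : ℝ) + 1) * exitCard F (nk k) ≤ (S + 1) * (ε * c₀ / 3 / (S + 1) * nk k) :=
        mul_le_mul_of_nonneg_left h2 (by positivity)
      have h9 : ((S : ℝ) + 1) * (ε * c₀ / 3 / (S + 1) * nk k) = ε * c₀ / 3 * nk k := by
        field_simp
      have h10 : ε * (c₀ * nk k) ≤ ε * secCard F (nk k) := mul_le_mul_of_nonneg_left h3 hε.le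
      linarith
    have h2 := mul_meas_ge_le_integral_of_nonneg (μ := ν) (f := fun x => g x)
      (Eventually.of_forall fun x => testFn_nonneg T ψ a N S x) (hgInt g) 1
    rw [one_mul] at h2
    exact (ENNReal.le_ofReal_iff_toReal_le (measure_ne_top ν _) hε.le).2 (h2.trans h1)
  let W : Set X := {x | ∃ L : ℝ, Tendsto (fun n => birkhoffAverage ℝ T ψ n x) atTop (𝓝 L) ∧ L < a}
  have hsub : ∀ N, W ⊆ ⋃ S₀ : ℕ, ⋂ S : ℕ, ⋂ _ : S₀ ≤ S, bad N S := by
    rintro N x ⟨L, hL, hLa⟩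
    obtain ⟨b, hLb, hba⟩ := exists_between hLa
    -- lower bound of the finitely many initial terms
    obtain ⟨K, hK⟩ : ∃ K : ℝ, ∀ k ∈ Finset.range (N + 1), k * a - birkhoffSum T ψ k x ≤ K := by
      obtain ⟨K, hK⟩ := ((Finset.range (N + 1)).image
        (fun k : ℕ => (k : ℝ) * a - birkhoffSum T ψ k x)).bddAbove
      exact ⟨K, fun k hk => hK (Finset.mem_coe.2 (Finset.mem_image_of_mem _ hk))⟩
    have hev : ∀ᶠ m : ℕ in atTop, 1 + K ≤ m * a - birkhoffSum T ψ m x := by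
      filter_upwards [hL.eventually_lt_const hLb, eventually_gt_atTop 0,
        tendsto_natCast_atTop_atTop.eventually_ge_atTop ((1 + K) / (a - b))] with m h1 h2 h3
      have hm : (0 : ℝ) < m := by exact_mod_cast h2
      have e : birkhoffAverage ℝ T ψ m x = (m : ℝ)⁻¹ * birkhoffSum T ψ m x := rfl
      rw [e, inv_mul_lt_iff₀ hm] at h1
      rw [div_le_iff₀ (by linarith)] at h3
      linarith
    obtain ⟨S₀, hS₀⟩ := eventually_atTop.1 hev
    refine mem_iUnion.2 ⟨S₀, mem_iInter₂.2 fun S hS => ?_⟩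
    have e : testFn T ψ a N S x = 1 := by
      refine Finset.prod_eq_one fun p hp => clamp_one ?_
      have h1 := hK p.1 (Finset.mem_product.1 hp).1
      have h2 := hS₀ (S + p.2) (by omega)
      unfold gap
      linarith
    exact e.ge
  have hW : ν W = 0 := by
    refine le_antisymm (ENNReal.le_of_forall_pos_le_add fun ε hε _ => ?_) bot_le
    obtain ⟨N, hN⟩ := key ε (by exact_mod_cast hε)
    rw [zero_add]
    refine (measure_mono (hsub N)).trans ?_
    have hmono : Monotone (fun S₀ : ℕ => ⋂ S : ℕ, ⋂ _ : S₀ ≤ S, bad N S) := by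
      intro s t hst x hx
      exact mem_iInter₂.2 fun S hS => mem_iInter₂.1 hx S (hst.trans hS)
    rw [hmono.measure_iUnion]
    refine iSup_le fun S₀ => ?_
    refine (measure_mono (iInter₂_subset (max S₀ N) (le_max_left _ _))).trans ?_
    simpa using hN _ (le_max_right S₀ N)
  filter_upwards [hBirk, measure_eq_zero_iff_ae_notMem.1 hW] with x hx hxW
  obtain ⟨L, hL⟩ := hx
  refine ⟨L, ?_, ?_⟩
  · refine hL.congr fun n => ?_
    rw [div_eq_inv_mul]; rfl
  · by_contra hlt
    exact hxW ⟨L, hL, not_le.1 hlt⟩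

end
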